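/- In an equilateral triangle T of unit area with side length L, if two of five given points in T are at distance at most 2L/5 from each other, then some three of the five points form a triangle of area at most 6/25. -/

import Mathlib

open MeasureTheory

noncomputable def triArea (p q r : EuclideanSpace ℝ (Fin 2)) : ℝ :=
  (volume (convexHull ℝ ({p, q, r} : Set (EuclideanSpace ℝ (Fin 2))))).toReal

/-- The cross product of two vectors of the Euclidean plane. -/
def planeCross (u v : EuclideanSpace ℝ (Fin 2)) : ℝ := u 0 * v 1 - u 1 * v 0

/-- The determinant of three points given by barycentric coordinates. -/
def baryDet (u v w : Fin 3 → ℝ) : ℝ :=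
  u 0 * (v 1 * w 2 - v 2 * w 1) + u 1 * (v 2 * w 0 - v 0 * w 2) +
    u 2 * (v 0 * w 1 - v 1 * w 0)

open scoped Pointwise in
theorem triArea_eq_abs_planeCross_mul (p q r : EuclideanSpace ℝ (Fin 2)) :
    triArea p q r = |planeCross (q - p) (r - p)| * triArea 0 !₂[1, 0] !₂[0, 1] := by
  set M : EuclideanSpace ℝ (Fin 2) →ₗ[ℝ] EuclideanSpace ℝ (Fin 2) :=
    Matrix.toLin (EuclideanSpace.basisFun (Fin 2) ℝ).toBasis
      (EuclideanSpace.basisFun (Fin 2) ℝ).toBasis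
      !![(q - p) 0, (r - p) 0; (q - p) 1, (r - p) 1] with hM
  have hdet : LinearMap.det M = planeCross (q - p) (r - p) := by
    rw [hM, LinearMap.det_toLin, Matrix.det_fin_two_of, planeCross]
    ring
  have h1 : M !₂[1, 0] = q - p := by
    have : (!₂[1, 0] : EuclideanSpace ℝ (Fin 2)) =
        (EuclideanSpace.basisFun (Fin 2) ℝ).toBasis 0 := by
      ext i; fin_cases i <;> simp
    rw [this, hM, Matrix.toLin_self]
    ext i; fin_cases i <;> simp [Fin.sum_univ_two]
  have h2 : M !₂[0, 1] = r - p := by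
    have : (!₂[0, 1] : EuclideanSpace ℝ (Fin 2)) =
        (EuclideanSpace.basisFun (Fin 2) ℝ).toBasis 1 := by
      ext i; fin_cases i <;> simp
    rw [this, hM, Matrix.toLin_self]
    ext i; fin_cases i <;> simp [Fin.sum_univ_two]
  have hset : convexHull ℝ ({p, q, r} : Set (EuclideanSpace ℝ (Fin 2))) =
      p +ᵥ M '' convexHull ℝ {0, !₂[1, 0], !₂[0, 1]} := by
    rw [LinearMap.image_convexHull, ← convexHull_vadd]
    simp [Set.image_insert_eq, h1, h2, ← Set.image_vadd]
  unfold triArea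
  rw [hset, measure_vadd, Measure.addHaar_image_linearMap, hdet, ENNReal.toReal_mul,
    ENNReal.toReal_ofReal (abs_nonneg _)]

theorem exists_barycentric_of_mem_convexHull_triple {A B C x : EuclideanSpace ℝ (Fin 2)}
    (hx : x ∈ convexHull ℝ ({A, B, C} : Set (EuclideanSpace ℝ (Fin 2)))) :
    ∃ u : Fin 3 → ℝ, (∀ i, 0 ≤ u i) ∧ u 0 + u 1 + u 2 = 1 ∧
      x = u 0 • A + u 1 • B + u 2 • C := by
  rw [convexHull_insert (by simp), mem_convexJoin] at hx
  obtain ⟨y, hy, z, hz, a, b, ha, hb, hab, rfl⟩ := hx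
  rw [convexHull_pair] at hz
  obtain ⟨c, d, hc, hd, hcd, rfl⟩ := hz
  rw [Set.mem_singleton_iff] at hy
  subst hy
  refine ⟨![a, b * c, b * d], ?_, ?_, ?_⟩
  · intro i; fin_cases i <;> simp <;> positivity
  · simp only [Matrix.cons_val]
    linear_combination hab + b * hcd
  · simp [smul_smul, add_assoc]

theorem planeCross_sub_eq_baryDet_mul (A B C : EuclideanSpace ℝ (Fin 2)) {u v w : Fin 3 → ℝ}
    (hu : u 0 + u 1 + u 2 = 1) (hv : v 0 + v 1 + v 2 = 1) (hw : w 0 + w 1 + w 2 = 1) :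
    planeCross ((v 0 • A + v 1 • B + v 2 • C) - (u 0 • A + u 1 • B + u 2 • C))
      ((w 0 • A + w 1 • B + w 2 • C) - (u 0 • A + u 1 • B + u 2 • C)) =
    baryDet u v w * planeCross (B - A) (C - A) := by
  have hu' : u 0 = 1 - u 1 - u 2 := by linarith
  have hv' : v 0 = 1 - v 1 - v 2 := by linarith
  have hw' : w 0 = 1 - w 1 - w 2 := by linarith
  simp only [planeCross, baryDet, PiLp.sub_apply, PiLp.add_apply, PiLp.smul_apply, smul_eq_mul,
    hu', hv', hw']
  ring

/-- In a triangle of unit area, areas are barycentric determinants. -/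
theorem triArea_eq_abs_baryDet {A B C : EuclideanSpace ℝ (Fin 2)} (hABC : triArea A B C = 1)
    {u v w : Fin 3 → ℝ}
    (hu : u 0 + u 1 + u 2 = 1) (hv : v 0 + v 1 + v 2 = 1) (hw : w 0 + w 1 + w 2 = 1) :
    triArea (u 0 • A + u 1 • B + u 2 • C) (v 0 • A + v 1 • B + v 2 • C)
      (w 0 • A + w 1 • B + w 2 • C) = |baryDet u v w| := by
  rw [triArea_eq_abs_planeCross_mul] at hABC
  rw [triArea_eq_abs_planeCross_mul, planeCross_sub_eq_baryDet_mul A B C hu hv hw, abs_mul,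
    mul_assoc, hABC, mul_one]

/-- Squared distances in an equilateral triangle, in barycentric coordinates. -/
theorem dist_sq_of_equilateral {L : ℝ} {A B C : EuclideanSpace ℝ (Fin 2)}
    (hAB : dist A B = L) (hBC : dist B C = L) (hAC : dist A C = L) {u v : Fin 3 → ℝ}
    (hu : u 0 + u 1 + u 2 = 1) (hv : v 0 + v 1 + v 2 = 1) :
    dist (u 0 • A + u 1 • B + u 2 • C) (v 0 • A + v 1 • B + v 2 • C) ^ 2 =
      L ^ 2 * ((u 1 - v 1) ^ 2 + (u 1 - v 1) * (u 2 - v 2) + (u 2 - v 2) ^ 2) := by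
  have key : ∀ x y : EuclideanSpace ℝ (Fin 2),
      dist x y ^ 2 = (x 0 - y 0) ^ 2 + (x 1 - y 1) ^ 2 := by
    intro x y
    rw [EuclideanSpace.dist_eq, Real.sq_sqrt (by positivity)]
    simp [Fin.sum_univ_two, Real.dist_eq, sq_abs]
  have h1 := key A B
  have h2 := key B C
  have h3 := key A C
  rw [hAB] at h1
  rw [hBC] at h2
  rw [hAC] at h3
  have hu' : u 0 = 1 - u 1 - u 2 := by linarith
  have hv' : v 0 = 1 - v 1 - v 2 := by linarith
  rw [key]
  simp only [PiLp.add_apply, PiLp.smul_apply, smul_eq_mul, hu', hv']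
  linear_combination
    (-((u 1 - v 1) ^ 2 + (u 1 - v 1) * (u 2 - v 2))) * h1 + ((u 1 - v 1) * (u 2 - v 2)) * h2
    - ((u 2 - v 2) ^ 2 + (u 1 - v 1) * (u 2 - v 2)) * h3

/-- A triangle with vertices in the right triangle `0 ≤ s, t`, `s + t ≤ g` has at most the area of
that right triangle. -/
theorem det_le_sq_of_mem_corner {g s₁ s₂ s₃ t₁ t₂ t₃ : ℝ} (hg : 0 < g)
    (hs₁ : 0 ≤ s₁) (hs₂ : 0 ≤ s₂) (hs₃ : 0 ≤ s₃) (ht₁ : 0 ≤ t₁) (ht₂ : 0 ≤ t₂) (ht₃ : 0 ≤ t₃)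
    (h₁ : s₁ + t₁ ≤ g) (h₂ : s₂ + t₂ ≤ g) (h₃ : s₃ + t₃ ≤ g) :
    s₁ * (t₂ - t₃) + s₂ * (t₃ - t₁) + s₃ * (t₁ - t₂) ≤ g ^ 2 := by
  have key : ∀ r₁ r₂ r₃ : ℝ, 0 ≤ r₁ → 0 ≤ r₂ → 0 ≤ r₃ →
      r₁ * s₂ * t₃ + s₁ * t₂ * r₃ + t₁ * r₂ * s₃ - (r₁ * t₂ * s₃ + s₁ * r₂ * t₃ + t₁ * s₂ * r₃) ≤
        (r₁ + s₁ + t₁) * (r₂ + s₂ + t₂) * (r₃ + s₃ + t₃) := by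
    intro r₁ r₂ r₃ hr₁ hr₂ hr₃
    rw [← sub_nonneg]
    ring_nf
    positivity
  have := key (g - s₁ - t₁) (g - s₂ - t₂) (g - s₃ - t₃) (by linarith) (by linarith) (by linarith)
  refine le_of_mul_le_mul_left ?_ hg
  linear_combination this

theorem sq_cap_le {x y δ : ℝ} (hy : 0 ≤ y) (hyx : y ≤ x)
    (hN : x ^ 2 - x * y + y ^ 2 ≤ 4 / 25) (hδ : x * y ≤ δ) (hg : 0 < x - δ - 6 / 25) :
    (x - δ - 6 / 25) ^ 2 ≤ 6 / 25 * (x * (x - y)) := by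
  have hδ0 : 0 ≤ δ := le_trans (mul_nonneg (hy.trans hyx) hy) hδ
  have hx : x ≤ 0.462 := by nlinarith [sq_nonneg (x - 2 * y)]
  rcases le_or_gt x (2 / 5) with h | h
  · have h1 : x - δ - 6 / 25 ≤ x * (x - y) := by nlinarith
    have h2 : x - δ - 6 / 25 ≤ 6 / 25 := by linarith
    nlinarith
  · have h1 : (x - δ - 6 / 25) * (x + 2 / 5) ≤ x * (x - y) := by
      have a1 : (x - 2 / 5) * (x + 2 / 5) ≤ x * (x - y) := by nlinarith
      have a2 : x - δ - 6 / 25 ≤ x * (x - y) + (x - 2 / 5) * (3 / 5 - x) := by nlinarith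
      have a3 : (x - δ - 6 / 25) * (x + 2 / 5) ≤
        (x * (x - y) + (x - 2 / 5) * (3 / 5 - x)) * (x + 2 / 5) := by
        gcongr
      nlinarith
    have h2 : x - δ - 6 / 25 ≤ 6 / 25 * (x + 2 / 5) := by
      rcases le_or_gt x 0.44 with h' | h'
      · nlinarith
      · have : 0.05 ≤ y := by
          by_contra! hc
          nlinarith
        nlinarith
    nlinarith

theorem abs_baryDet_le_of_ordered {α β γ : ℝ} (hαγ : α ≤ γ) (hγβ : γ ≤ β)
    (hN : (β - α) ^ 2 - (β - α) * (γ - α) + (γ - α) ^ 2 ≤ 4 / 25)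
    (hα : (β - α) * (γ - α) ≤ -α) {u v w : Fin 3 → ℝ}
    (hu : ∀ i, 0 ≤ u i) (hv : ∀ i, 0 ≤ v i) (hw : ∀ i, 0 ≤ w i)
    (hu1 : u 0 + u 1 + u 2 = 1) (hv1 : v 0 + v 1 + v 2 = 1) (hw1 : w 0 + w 1 + w 2 = 1)
    (hfu : 6 / 25 < α * u 0 + β * u 1 + γ * u 2) (hfv : 6 / 25 < α * v 0 + β * v 1 + γ * v 2)
    (hfw : 6 / 25 < α * w 0 + β * w 1 + γ * w 2) : |baryDet u v w| ≤ 6 / 25 := by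
  have cap : ∀ {z : Fin 3 → ℝ}, z 0 + z 1 + z 2 = 1 → 6 / 25 < α * z 0 + β * z 1 + γ * z 2 →
      z 0 * (β - α) + z 2 * (β - γ) ≤ β - 6 / 25 := fun h1 h2 => by
    linear_combination h2.le + β * h1
  have hg : 0 < β - 6 / 25 := by
    have : 0 ≤ u 0 * (β - α) := mul_nonneg (hu 0) (by linarith)
    have : 0 ≤ u 2 * (β - γ) := mul_nonneg (hu 2) (by linarith)
    linear_combination this + ‹0 ≤ u 0 * (β - α)› + hfu + β * hu1
  have hx : 0 ≤ β - α := by linarith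
  have hz : 0 ≤ β - γ := by linarith
  have hsq := sq_cap_le (x := β - α) (y := γ - α) (δ := -α) (by linarith) (by linarith) hN hα
    (by linarith)
  have hsq' : (β - 6 / 25) ^ 2 ≤ 6 / 25 * ((β - α) * (β - γ)) := by
    linear_combination hsq
  have hpos : 0 < (β - α) * (β - γ) := by nlinarith
  have h1 := det_le_sq_of_mem_corner hg (mul_nonneg (hu 0) hx) (mul_nonneg (hv 0) hx)
    (mul_nonneg (hw 0) hx) (mul_nonneg (hu 2) hz) (mul_nonneg (hv 2) hz) (mul_nonneg (hw 2) hz)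
    (cap hu1 hfu) (cap hv1 hfv) (cap hw1 hfw)
  have h2 := det_le_sq_of_mem_corner hg (mul_nonneg (hv 0) hx) (mul_nonneg (hu 0) hx)
    (mul_nonneg (hw 0) hx) (mul_nonneg (hv 2) hz) (mul_nonneg (hu 2) hz) (mul_nonneg (hw 2) hz)
    (cap hv1 hfv) (cap hu1 hfu) (cap hw1 hfw)
  have hdet : baryDet u v w = -(u 0 * (v 2 - w 2) + v 0 * (w 2 - u 2) + w 0 * (u 2 - v 2)) := by
    have hu' : u 1 = 1 - u 0 - u 2 := by linarith
    have hv' : v 1 = 1 - v 0 - v 2 := by linarith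
    have hw' : w 1 = 1 - w 0 - w 2 := by linarith
    simp only [baryDet, hu', hv', hw']
    ring
  rw [hdet, abs_le]
  constructor <;> refine le_of_mul_le_mul_left ?_ hpos <;> linarith

theorem abs_baryDet_le_of_min {α β γ : ℝ} (hαβ : α ≤ β) (hαγ : α ≤ γ)
    (hN : (β - α) ^ 2 - (β - α) * (γ - α) + (γ - α) ^ 2 ≤ 4 / 25)
    (hα : (β - α) * (γ - α) ≤ -α) {u v w : Fin 3 → ℝ}
    (hu : ∀ i, 0 ≤ u i) (hv : ∀ i, 0 ≤ v i) (hw : ∀ i, 0 ≤ w i)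
    (hu1 : u 0 + u 1 + u 2 = 1) (hv1 : v 0 + v 1 + v 2 = 1) (hw1 : w 0 + w 1 + w 2 = 1)
    (hfu : 6 / 25 < α * u 0 + β * u 1 + γ * u 2) (hfv : 6 / 25 < α * v 0 + β * v 1 + γ * v 2)
    (hfw : 6 / 25 < α * w 0 + β * w 1 + γ * w 2) : |baryDet u v w| ≤ 6 / 25 := by
  rcases le_total γ β with h | h
  · exact abs_baryDet_le_of_ordered hαγ h hN hα hu hv hw hu1 hv1 hw1 hfu hfv hfw
  · have hdet : baryDet u v w =
        -baryDet ![u 0, u 2, u 1] ![v 0, v 2, v 1] ![w 0, w 2, w 1] := by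
      simp only [baryDet, Matrix.cons_val]
      ring
    rw [hdet, abs_neg]
    apply abs_baryDet_le_of_ordered hαβ h (by linarith) (by linarith) <;>
      simp only [Fin.forall_fin_succ, Matrix.cons_val, Fin.succ_zero_eq_one, Fin.succ_one_eq_two,
        IsEmpty.forall_iff, and_true] <;>
      first
        | linarith
        | exact ⟨hu 0, hu 2, hu 1⟩
        | exact ⟨hv 0, hv 2, hv 1⟩
        | exact ⟨hw 0, hw 2, hw 1⟩

/-- Here `α`, `β`, `γ` are the values at the vertices of an affine function vanishing at two points
of the triangle that are close to each other. -/
theorem abs_baryDet_le {α β γ : ℝ}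
    (hN : (β - α) ^ 2 - (β - α) * (γ - α) + (γ - α) ^ 2 ≤ 4 / 25)
    (hα : α ≤ β → α ≤ γ → (β - α) * (γ - α) ≤ -α)
    (hβ : β ≤ γ → β ≤ α → (γ - β) * (α - β) ≤ -β)
    (hγ : γ ≤ α → γ ≤ β → (α - γ) * (β - γ) ≤ -γ) {u v w : Fin 3 → ℝ}
    (hu : ∀ i, 0 ≤ u i) (hv : ∀ i, 0 ≤ v i) (hw : ∀ i, 0 ≤ w i)
    (hu1 : u 0 + u 1 + u 2 = 1) (hv1 : v 0 + v 1 + v 2 = 1) (hw1 : w 0 + w 1 + w 2 = 1)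
    (hfu : 6 / 25 < α * u 0 + β * u 1 + γ * u 2) (hfv : 6 / 25 < α * v 0 + β * v 1 + γ * v 2)
    (hfw : 6 / 25 < α * w 0 + β * w 1 + γ * w 2) : |baryDet u v w| ≤ 6 / 25 := by
  have rotate : ∀ {u v w : Fin 3 → ℝ}, baryDet u v w =
      baryDet ![u 1, u 2, u 0] ![v 1, v 2, v 0] ![w 1, w 2, w 0] := by
    intro u v w
    simp only [baryDet, Matrix.cons_val]
    ring
  have hmin : (α ≤ β ∧ α ≤ γ) ∨ (β ≤ γ ∧ β ≤ α) ∨ (γ ≤ α ∧ γ ≤ β) := by grind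
  rcases hmin with ⟨h₁, h₂⟩ | ⟨h₁, h₂⟩ | ⟨h₁, h₂⟩
  · exact abs_baryDet_le_of_min h₁ h₂ hN (hα h₁ h₂) hu hv hw hu1 hv1 hw1 hfu hfv hfw
  · rw [rotate]
    apply abs_baryDet_le_of_min h₁ h₂ (by linarith) (hβ h₁ h₂) <;>
      simp only [Fin.forall_fin_succ, Matrix.cons_val, Fin.succ_zero_eq_one, Fin.succ_one_eq_two,
        IsEmpty.forall_iff, and_true] <;>
      first
        | linarith
        | exact ⟨hu 1, hu 2, hu 0⟩
        | exact ⟨hv 1, hv 2, hv 0⟩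
        | exact ⟨hw 1, hw 2, hw 0⟩
  · rw [rotate, rotate]
    apply abs_baryDet_le_of_min h₁ h₂ (by linarith) (hγ h₁ h₂) <;>
      simp only [Fin.forall_fin_succ, Matrix.cons_val, Fin.succ_zero_eq_one, Fin.succ_one_eq_two,
        IsEmpty.forall_iff, and_true] <;>
      first
        | linarith
        | exact ⟨hu 2, hu 0, hu 1⟩
        | exact ⟨hv 2, hv 0, hv 1⟩
        | exact ⟨hw 2, hw 0, hw 1⟩

theorem exists_three_other_indices {i j : Fin 5} (h : i ≠ j) :
    ∃ k l m : Fin 5, k ≠ l ∧ k ≠ m ∧ l ≠ m ∧ i ≠ k ∧ i ≠ l ∧ i ≠ m ∧ j ≠ k ∧ j ≠ l ∧ j ≠ m := by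
  revert i j
  decide

/-- The value of the linear function `baryDet p q` at a vertex where it is smallest. -/
theorem mul_sub_le_of_chord {p₁ p₂ p₃ q₁ q₂ q₃ : ℝ} (hp₂ : 0 ≤ p₂) (hq₃ : 0 ≤ q₃)
    (hp1 : p₁ + p₂ + p₃ = 1) (hq1 : q₁ + q₂ + q₃ = 1)
    (h₁ : p₂ * q₃ - p₃ * q₂ ≤ p₃ * q₁ - p₁ * q₃) (h₂ : p₂ * q₃ - p₃ * q₂ ≤ p₁ * q₂ - p₂ * q₁) :
    (p₃ * q₁ - p₁ * q₃ - (p₂ * q₃ - p₃ * q₂)) * (p₁ * q₂ - p₂ * q₁ - (p₂ * q₃ - p₃ * q₂)) ≤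
      -(p₂ * q₃ - p₃ * q₂) := by
  obtain rfl : p₁ = 1 - p₂ - p₃ := by linarith
  obtain rfl : q₁ = 1 - q₂ - q₃ := by linarith
  have h1 : q₃ ≤ p₃ := by linarith
  have h2 : p₂ ≤ q₂ := by linarith
  nlinarith [mul_nonneg hp₂ (sub_nonneg.2 h1), mul_nonneg hq₃ (sub_nonneg.2 h2)]

theorem abs_baryDet_le_of_close {p q u v w : Fin 3 → ℝ} (hp : ∀ i, 0 ≤ p i) (hq : ∀ i, 0 ≤ q i)
    (hu : ∀ i, 0 ≤ u i) (hv : ∀ i, 0 ≤ v i) (hw : ∀ i, 0 ≤ w i)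
    (hp1 : p 0 + p 1 + p 2 = 1) (hq1 : q 0 + q 1 + q 2 = 1)
    (hu1 : u 0 + u 1 + u 2 = 1) (hv1 : v 0 + v 1 + v 2 = 1) (hw1 : w 0 + w 1 + w 2 = 1)
    (hpq : (p 1 - q 1) ^ 2 + (p 1 - q 1) * (p 2 - q 2) + (p 2 - q 2) ^ 2 ≤ 4 / 25)
    (hfu : 6 / 25 < baryDet p q u) (hfv : 6 / 25 < baryDet p q v) (hfw : 6 / 25 < baryDet p q w) :
    |baryDet u v w| ≤ 6 / 25 := by
  have hp' : p 0 = 1 - p 1 - p 2 := by linarith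
  have hq' : q 0 = 1 - q 1 - q 2 := by linarith
  refine abs_baryDet_le (α := p 1 * q 2 - p 2 * q 1) (β := p 2 * q 0 - p 0 * q 2)
    (γ := p 0 * q 1 - p 1 * q 0) ?_ ?_ ?_ ?_ hu hv hw hu1 hv1 hw1 ?_ ?_ ?_
  · rw [hp', hq']
    linear_combination hpq
  · exact mul_sub_le_of_chord (hp 1) (hq 2) hp1 hq1
  · exact mul_sub_le_of_chord (hp 2) (hq 0) (by linarith) (by linarith)
  · exact mul_sub_le_of_chord (hp 0) (hq 1) (by linarith) (by linarith)
  all_goals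
    simp only [baryDet] at hfu hfv hfw
    linarith

theorem baryDet_swap (p q u : Fin 3 → ℝ) : baryDet q p u = -baryDet p q u := by
  simp only [baryDet]
  ring

/-- Points at large signed distances on opposite sides of a line through two close points cannot
both lie in the triangle. -/
theorem not_opposite_sides_of_close {p q u v : Fin 3 → ℝ}
    (hu : ∀ i, 0 ≤ u i) (hv : ∀ i, 0 ≤ v i)
    (hp1 : p 0 + p 1 + p 2 = 1) (hq1 : q 0 + q 1 + q 2 = 1)
    (hu1 : u 0 + u 1 + u 2 = 1) (hv1 : v 0 + v 1 + v 2 = 1)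
    (hpq : (p 1 - q 1) ^ 2 + (p 1 - q 1) * (p 2 - q 2) + (p 2 - q 2) ^ 2 ≤ 4 / 25)
    (hfu : 6 / 25 < baryDet p q u) (hfv : baryDet p q v < -(6 / 25)) : False := by
  obtain ⟨y, hy⟩ : ∃ y, y = p 1 - q 1 := ⟨_, rfl⟩
  obtain ⟨z, hz⟩ : ∃ z, z = p 2 - q 2 := ⟨_, rfl⟩
  rw [← hy, ← hz] at hpq
  have hdiff : baryDet p q u - baryDet p q v = z * (u 1 - v 1) - y * (u 2 - v 2) := by
    have hp' : p 0 = 1 - p 1 - p 2 := by linarith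
    have hq' : q 0 = 1 - q 1 - q 2 := by linarith
    have hu' : u 0 = 1 - u 1 - u 2 := by linarith
    have hv' : v 0 = 1 - v 1 - v 2 := by linarith
    simp only [baryDet, hp', hq', hu', hv', hy, hz]
    ring
  have hy1 : |y| ≤ 0.47 := abs_le_of_sq_le_sq (by nlinarith [sq_nonneg (y + 2 * z)]) (by norm_num)
  have hz1 : |z| ≤ 0.47 := abs_le_of_sq_le_sq (by nlinarith [sq_nonneg (2 * y + z)]) (by norm_num)
  have hyz : |y + z| ≤ 0.47 := abs_le_of_sq_le_sq (by nlinarith [sq_nonneg (y - z)]) (by norm_num)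
  rw [abs_le] at hy1 hz1 hyz
  have hexp : z * (u 1 - v 1) - y * (u 2 - v 2) =
      z * (u 1 * v 0) - z * (u 0 * v 1) + y * (u 0 * v 2) - y * (u 2 * v 0) +
        (y + z) * (u 1 * v 2) - (y + z) * (u 2 * v 1) := by
    linear_combination (z * v 1 - y * v 2) * hu1 - (z * u 1 - y * u 2) * hv1
  have hone : (u 0 + u 1 + u 2) * (v 0 + v 1 + v 2) = 1 := by rw [hu1, hv1, one_mul]
  have hnn : ∀ i j, 0 ≤ u i * v j := fun i j => mul_nonneg (hu i) (hv j)
  linarith [mul_le_mul_of_nonneg_right hz1.2 (hnn 1 0), mul_le_mul_of_nonneg_right hz1.1 (hnn 0 1),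
    mul_le_mul_of_nonneg_right hy1.2 (hnn 0 2), mul_le_mul_of_nonneg_right hy1.1 (hnn 2 0),
    mul_le_mul_of_nonneg_right hyz.2 (hnn 1 2), mul_le_mul_of_nonneg_right hyz.1 (hnn 2 1),
    hnn 0 0, hnn 1 1, hnn 2 2]

theorem stmt_9 (L : ℝ) (A B C : EuclideanSpace ℝ (Fin 2))
    (hAB : dist A B = L) (hBC : dist B C = L) (hAC : dist A C = L)
    (hABC : triArea A B C = 1)
    (p : Fin 5 → EuclideanSpace ℝ (Fin 2))
    (hp : ∀ i, p i ∈ convexHull ℝ ({A, B, C} : Set (EuclideanSpace ℝ (Fin 2))))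
    (hclose : ∃ i j : Fin 5, i ≠ j ∧ dist (p i) (p j) ≤ 2 * L / 5) :
    ∃ i j k : Fin 5, i ≠ j ∧ i ≠ k ∧ j ≠ k ∧ triArea (p i) (p j) (p k) ≤ 6 / 25 := by
  have hL : 0 < L := by
    have hL0 : 0 ≤ L := hAB ▸ dist_nonneg
    refine lt_of_le_of_ne hL0 fun h => ?_
    obtain rfl : A = B := dist_eq_zero.1 (hAB.trans h.symm)
    rw [triArea_eq_abs_planeCross_mul] at hABC
    simp [planeCross] at hABC
  choose b hb0 hb1 hpb using fun i => exists_barycentric_of_mem_convexHull_triple (hp i)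
  have harea : ∀ i j k, triArea (p i) (p j) (p k) = |baryDet (b i) (b j) (b k)| := by
    intro i j k
    rw [hpb i, hpb j, hpb k, triArea_eq_abs_baryDet hABC (hb1 i) (hb1 j) (hb1 k)]
  have hnorm : ∀ i j, dist (p i) (p j) ≤ 2 * L / 5 →
      (b i 1 - b j 1) ^ 2 + (b i 1 - b j 1) * (b i 2 - b j 2) + (b i 2 - b j 2) ^ 2 ≤ 4 / 25 := by
    intro i j h
    have h1 := pow_le_pow_left₀ dist_nonneg h 2
    rw [hpb i, hpb j, dist_sq_of_equilateral hAB hBC hAC (hb1 i) (hb1 j)] at h1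
    exact le_of_mul_le_mul_left (by linarith) (pow_pos hL 2)
  obtain ⟨i, j, hij, hd⟩ := hclose
  have hd' := hnorm j i (dist_comm (p i) (p j) ▸ hd)
  replace hd := hnorm i j hd
  obtain ⟨k, l, m, hkl, hkm, hlm, hik, hil, him, hjk, hjl, hjm⟩ := exists_three_other_indices hij
  by_contra! hcon
  simp only [harea] at hcon
  have hk := lt_abs.1 (hcon i j k hij hik hjk)
  have hl := lt_abs.1 (hcon i j l hij hil hjl)
  have hm := lt_abs.1 (hcon i j m hij him hjm)
  have hklm := hcon k l m hkl hkm hlm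
  have hopp : ∀ s t, 6 / 25 < baryDet (b i) (b j) (b s) → 6 / 25 < -baryDet (b i) (b j) (b t) →
      False := fun s t hs ht =>
    not_opposite_sides_of_close (hb0 s) (hb0 t) (hb1 i) (hb1 j) (hb1 s) (hb1 t) hd hs
      (by linarith)
  rcases hk with hk | hk
  · exact hklm.not_ge <| abs_baryDet_le_of_close (hb0 i) (hb0 j) (hb0 k) (hb0 l) (hb0 m) (hb1 i)
      (hb1 j) (hb1 k) (hb1 l) (hb1 m) hd hk (hl.resolve_right (hopp k l hk))
      (hm.resolve_right (hopp k m hk))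
  · have hl' := hl.resolve_left fun h => hopp l k h hk
    have hm' := hm.resolve_left fun h => hopp m k h hk
    rw [← baryDet_swap] at hk hl' hm'
    exact hklm.not_ge <| abs_baryDet_le_of_close (hb0 j) (hb0 i) (hb0 k) (hb0 l) (hb0 m) (hb1 j)
      (hb1 i) (hb1 k) (hb1 l) (hb1 m) hd' hk hl' hm'
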